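/- arXiv:1512.01799 — 3 statements merged into one kernel-verified Lean document; each statement's English description precedes it below -/
import Mathlib

section
/- Let n ≥ 2 and let x, t be elements of a commutative ring (e.g. x, t ∈ ℝ). Then Σ_{π ∈ D_n} x^{exc(π)} (−1)^{cdes(π)} t^{π^{-1}(1)} = Σ_{i=2}^{n} (−1)^{n−i} x^{i−1} t^{i}, where D_n is the set of derangements of [n] and π^{-1}(1) is the index i with π(i) = 1. -/
open Equiv Finset

/-- Number of excedances of a permutation of `Fin n` (`π i > i`). -/
def exc {n : ℕ} (π : Equiv.Perm (Fin n)) : ℕ :=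
  (Finset.univ.filter fun i => i < π i).card

/-- Number of fixed points. -/
def fixpts {n : ℕ} (π : Equiv.Perm (Fin n)) : ℕ :=
  (Finset.univ.filter fun i => π i = i).card

/-- The set of cycle descents of `π`: those `c` with `π c < c` such that `π c`
is not the smallest element of the cycle containing `c`. -/
def cdesSet {n : ℕ} (π : Equiv.Perm (Fin n)) : Finset (Fin n) :=
  Finset.univ.filter fun c => π c < c ∧ ∃ j, π.SameCycle c j ∧ j < π c

/-- The number of cycle descents of `π`. -/
def cdes {n : ℕ} (π : Equiv.Perm (Fin n)) : ℕ := (cdesSet π).card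

/-- The number of cycles of `π`, counted via cycle minima. -/
def cyc {n : ℕ} (π : Equiv.Perm (Fin n)) : ℕ :=
  (Finset.univ.filter fun c : Fin n => ∀ j, π.SameCycle c j → c ≤ j).card

/-- The weighted matrix: first column `v`, `y` above the diagonal, `1` below, `0` on it. -/
def wMat (m : ℕ) (y : ℝ) (v : Fin (m + 2) → ℝ) : Matrix (Fin (m + 2)) (Fin (m + 2)) ℝ :=
  fun i j => if j = 0 then v i else if i < j then y else if j < i then 1 else 0

theorem wMat_rec (m : ℕ) (y : ℝ) (v : Fin (m + 3) → ℝ) :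
    (wMat (m + 1) y v).det =
      (v 0 - v 1) * (wMat m y (fun i => if i = 0 then 0 else 1)).det
        - y * (wMat m y (fun i => v i.succ)).det := by
  have h01 : (0 : Fin (m + 3)) ≠ 1 := by simp [Fin.ext_iff]
  rw [← Matrix.det_updateRow_add_smul_self (wMat (m + 1) y v) h01 (-1)]
  rw [Matrix.det_succ_row_zero, Fin.sum_univ_succ, Fin.sum_univ_succ]
  have hz : ∀ j : Fin (m + 1), wMat (m + 1) y v 0 j.succ.succ - wMat (m + 1) y v 1 j.succ.succ = 0 := by
    intro j
    have h1 : (1 : Fin (m + 3)) < j.succ.succ := by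
      rw [Fin.lt_def]; simp
    have h2 : (0 : Fin (m + 3)) < j.succ.succ := Fin.succ_pos _
    simp [wMat, h1, h2]
  rw [Finset.sum_eq_zero (s := (Finset.univ : Finset (Fin (m + 1))))]
  · have e1 : (((wMat (m + 1) y v).updateRow 0 (wMat (m + 1) y v 0 + (-1 : ℝ) • wMat (m + 1) y v 1)).submatrix
        Fin.succ (Fin.succAbove 0)) = wMat m y (fun i => if i = 0 then 0 else 1) := by
      ext i j
      simp only [Matrix.submatrix_apply, Matrix.updateRow_ne (Fin.succ_ne_zero i), wMat,
        Fin.zero_succAbove, Fin.succ_ne_zero, if_false, Fin.succ_lt_succ_iff]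
      by_cases hj : j = 0
      · subst hj
        by_cases hi : i = 0
        · simp [hi]
        · simp [hi, Fin.pos_iff_ne_zero]
      · simp [hj]
    have e2 : (((wMat (m + 1) y v).updateRow 0 (wMat (m + 1) y v 0 + (-1 : ℝ) • wMat (m + 1) y v 1)).submatrix
        Fin.succ (Fin.succAbove (Fin.succ 0))) = wMat m y (fun i => v i.succ) := by
      ext i j
      simp only [Matrix.submatrix_apply, Matrix.updateRow_ne (Fin.succ_ne_zero i), wMat]
      by_cases hj : j = 0
      · subst hj
        simp
      · obtain ⟨k, rfl⟩ := Fin.exists_succ_eq.2 hj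
        simp [Fin.succ_succAbove_succ, Fin.succ_lt_succ_iff]
    rw [e1, e2]
    simp [wMat]
    ring
  · intro j _
    have := hz j
    simp only [Matrix.updateRow_self, Pi.add_apply, Pi.smul_apply, smul_eq_mul]
    rw [show wMat (m + 1) y v 0 j.succ.succ + -1 * wMat (m + 1) y v 1 j.succ.succ = 0 by linarith]
    simp

theorem wMat_det (m : ℕ) (y : ℝ) (v : Fin (m + 2) → ℝ) :
    (wMat m y v).det = (-1) ^ (m + 1) *
      (∑ i : Fin (m + 1), y ^ (i.val + 1) * v i.succ - (∑ k ∈ range m, y ^ (k + 1)) * v 0) := by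
  induction m with
  | zero => simp [Matrix.det_fin_two, wMat]
  | succ m ih =>
    rw [wMat_rec, ih, ih, Fin.sum_univ_succ (n := m + 1)]
    simp only [Fin.succ_ne_zero, if_false, if_true, mul_one, mul_zero, sub_zero]
    rw [Finset.sum_range (fun k => y ^ (k + 1))]
    rw [Finset.sum_range (fun k => y ^ (k + 1))]
    have e : ∑ i : Fin (m + 1), y ^ ((i.succ : Fin (m+2)).val + 1) * v i.succ.succ =
        y * ∑ i : Fin (m + 1), y ^ (i.val + 1) * v i.succ.succ := by
      rw [Finset.mul_sum]
      refine Finset.sum_congr rfl fun i _ => ?_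
      simp only [Fin.val_succ]; ring
    have e3 : ∑ i : Fin (m + 1), y ^ (i.val + 1) = y + y * ∑ i : Fin m, y ^ (i.val + 1) := by
      rw [Fin.sum_univ_succ, Finset.mul_sum]
      simp only [Fin.val_succ, Fin.val_zero, zero_add, pow_one]
      congr 1
      refine Finset.sum_congr rfl fun i _ => ?_
      ring
    rw [e, e3]
    simp only [Fin.succ_zero_eq_one, Fin.val_zero]
    ring

theorem cyc_eq_card {n : ℕ} (π : Perm (Fin n)) (h : ∀ j, π j ≠ j) :
    cyc π = π.cycleFactorsFinset.card := by
  unfold cyc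
  refine Finset.card_bij (fun c _ => π.cycleOf c) ?_ ?_ ?_
  · intro c _
    exact Perm.cycleOf_mem_cycleFactorsFinset_iff.2 (Perm.mem_support.2 (h c))
  · intro a ha b hb hab
    simp only [mem_filter, mem_univ, true_and] at ha hb
    have hs : π.SameCycle a b := by
      have : b ∈ (π.cycleOf a).support := by
        rw [hab, Perm.mem_support_cycleOf_iff]
        exact ⟨Perm.SameCycle.refl _ _, Perm.mem_support.2 (h b)⟩
      exact (Perm.mem_support_cycleOf_iff.1 this).1
    exact le_antisymm (ha b hs) (hb a hs.symm)
  · intro f hf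
    have hne : f.support.Nonempty := by
      rw [Perm.mem_cycleFactorsFinset_iff] at hf
      exact hf.1.nonempty_support
    refine ⟨f.support.min' hne, ?_, ?_⟩
    · simp only [mem_filter, mem_univ, true_and]
      intro j hj
      apply Finset.min'_le
      have hm := Finset.min'_mem _ hne
      have := Perm.cycle_is_cycleOf hm hf
      rw [this, Perm.mem_support_cycleOf_iff]
      exact ⟨hj, Perm.mem_support.2 (h _)⟩
    · exact (Perm.cycle_is_cycleOf (Finset.min'_mem _ hne) hf).symm

theorem exc_add_cdes {n : ℕ} (π : Perm (Fin n)) (h : ∀ j, π j ≠ j) :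
    exc π + cdes π + cyc π = n := by
  have hc : cyc π = (univ.filter fun c => π c < c ∧ ¬ ∃ j, π.SameCycle c j ∧ j < π c).card := by
    unfold cyc
    symm
    refine Finset.card_bij (fun c _ => π c) ?_ ?_ ?_
    · intro c hc
      simp only [mem_filter, mem_univ, true_and, not_exists, not_and, not_lt] at hc ⊢
      intro j hj
      exact hc.2 j (Perm.sameCycle_apply_left.1 hj)
    · intro a _ b _ hab
      exact π.injective hab
    · intro b hb
      simp only [mem_filter, mem_univ, true_and] at hb
      refine ⟨π.symm b, ?_, by simp⟩
      simp only [mem_filter, mem_univ, true_and, not_exists, not_and, not_lt, apply_symm_apply]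
      have hs : π.SameCycle b (π.symm b) := by
        have : π.SameCycle (π (π.symm b)) (π.symm b) :=
          Perm.sameCycle_apply_left.2 (Perm.SameCycle.refl _ _)
        simpa using this
      refine ⟨lt_of_le_of_ne (hb _ hs) ?_, fun j hj => hb j (hs.trans hj)⟩
      intro hh
      exact h b (by conv_lhs => rw [hh]
                    simp)
  have h1 : cdes π + cyc π = (univ.filter fun c => π c < c).card := by
    rw [hc, cdes, cdesSet, ← Finset.filter_filter, ← Finset.filter_filter]
    exact Finset.card_filter_add_card_filter_not _
  have h2 := Finset.card_filter_add_card_filter_not (s := (univ : Finset (Fin n))) (fun i => i < π i)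
  have h3 : (univ.filter fun c => ¬ c < π c) = (univ.filter fun c => π c < c) := by
    ext c
    simp only [mem_filter, mem_univ, true_and, not_lt]
    exact ⟨fun hh => lt_of_le_of_ne hh (h c), le_of_lt⟩
  rw [h3] at h2
  rw [add_assoc, h1, exc, h2]
  simp

theorem neg_one_pow_cdes {n : ℕ} (π : Perm (Fin n)) (h : ∀ j, π j ≠ j) :
    (-1 : ℝ) ^ cdes π = ((Perm.sign π : ℤ) : ℝ) * (-1) ^ exc π := by
  have hs : Perm.sign π = (-1) ^ (n + cyc π) := by
    rw [Perm.sign_of_cycleType, Perm.sum_cycleType, cyc_eq_card π h]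
    have : π.support = univ := by
      ext j; simp [h j]
    rw [this]
    simp [Perm.cycleType_def]
  have hn := exc_add_cdes π h
  rw [hs]
  push_cast
  rw [← pow_add]
  have : n + cyc π + exc π = cdes π + 2 * (exc π + cyc π) := by omega
  rw [this, pow_add, pow_mul]
  simp

theorem signed_exc_position_enumerator_derangements (n : ℕ) (hn : 2 ≤ n) (x t : ℝ) :
    (∑ π ∈ Finset.univ.filter (fun π : Equiv.Perm (Fin n) => ∀ j, π j ≠ j),
        x ^ exc π * (-1 : ℝ) ^ cdes π * t ^ ((π.symm ⟨0, by omega⟩).val + 1)) =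
      ∑ i ∈ Finset.Icc 2 n, (-1 : ℝ) ^ (n - i) * x ^ (i - 1) * t ^ i := by
  obtain ⟨m, rfl⟩ : ∃ m, n = m + 2 := ⟨n - 2, by omega⟩
  have hz : (⟨0, by omega⟩ : Fin (m + 2)) = 0 := rfl
  rw [hz]
  have key := wMat_det m (-x) (fun i => if i = 0 then 0 else t ^ (i.val + 1))
  rw [← Matrix.det_transpose, Matrix.det_apply] at key
  trans ∑ i : Fin (m + 1), (-1 : ℝ) ^ (m - i.val) * x ^ (i.val + 1) * t ^ (i.val + 2)
  · trans (-1) ^ (m + 1) * (∑ i : Fin (m + 1), (-x) ^ (i.val + 1) * t ^ (i.val + 2))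
    · simp only [if_true, mul_zero, sub_zero, Fin.succ_ne_zero, if_false, Fin.val_succ] at key
      rw [← key]
      rw [Finset.sum_filter]
      refine Finset.sum_congr rfl fun π _ => ?_
      split_ifs with h
      · rw [neg_one_pow_cdes π h]
        have hp : ∏ i, (wMat m (-x) (fun i => if i = 0 then 0 else t ^ (i.val + 1))).transpose (π i) i
            = ∏ i, ((if i < π i then (-x) else 1) * (if i = π.symm 0 then t ^ (i.val + 1) else 1)) := by
          refine Finset.prod_congr rfl fun i _ => ?_
          simp only [Matrix.transpose_apply, wMat, Equiv.eq_symm_apply]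
          by_cases h0 : π i = 0
          · have : i ≠ 0 := by
              rintro rfl; exact h 0 h0
            simp [h0, this]
          · have h' := h i
            rcases lt_or_gt_of_ne h' with h1 | h1
            · simp [h0, h1, h1.le, not_lt.2 h1.le]
            · simp [h0, h1]
        rw [hp, Finset.prod_mul_distrib, Finset.prod_ite_eq' , Finset.prod_ite]
        simp only [mem_univ, if_true, prod_const, one_pow, mul_one]
        rw [show (univ.filter fun i => i < π i).card = exc π from rfl, neg_pow x]
        rw [Units.smul_def, zsmul_eq_mul]
        ring
      · push Not at h
        obtain ⟨j, hj⟩ := h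
        rw [Finset.prod_eq_zero (mem_univ j)]
        · simp
        · simp only [Matrix.transpose_apply, wMat, hj]
          by_cases h0 : j = 0 <;> simp [h0]
    · rw [Finset.mul_sum]
      refine Finset.sum_congr rfl fun i _ => ?_
      rw [neg_pow x, ← mul_assoc, ← mul_assoc, ← pow_add]
      have : m + 1 + (i.val + 1) = (m - i.val) + 2 * (i.val + 1) := by omega
      rw [this, pow_add, pow_mul]
      simp
  · rw [Fin.sum_univ_eq_sum_range (fun i => (-1 : ℝ) ^ (m - i) * x ^ (i + 1) * t ^ (i + 2))]
    have : Finset.Icc 2 (m + 2) = Finset.Ico (0 + 2) (m + 1 + 2) := by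
      ext; simp; omega
    rw [this, ← Finset.sum_Ico_add', Finset.range_eq_Ico]
    refine Finset.sum_congr rfl fun i _ => ?_
    rw [show m + 2 - (i + 2) = m - i by omega, show i + 2 - 1 = i + 1 by omega]
end

section
/- For every n ≥ 1, Σ_{π ∈ D_n} (−1)^{cdes(π)} = (1 − (−1)^{n−1})/2; equivalently, this signed sum over derangements of [n] equals 1 if n is even and 0 if n is odd. -/
open Equiv Finset

/-- Antisymmetric sign matrix. -/
def skewM (n : ℕ) : Matrix (Fin n) (Fin n) ℝ :=
  fun i j => if j < i then -1 else if i < j then 1 else 0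

theorem skewM_rec (n : ℕ) : (skewM (2 + n)).det = (skewM n).det := by
  rw [← Matrix.det_submatrix_equiv_self (finSumFinEquiv : Fin 2 ⊕ Fin n ≃ Fin (2 + n))]
  have h : (skewM (2 + n)).submatrix finSumFinEquiv finSumFinEquiv
      = Matrix.fromBlocks (!![0, 1; -1, 0] : Matrix (Fin 2) (Fin 2) ℝ)
          (Matrix.of fun _ _ => 1) (Matrix.of fun _ _ => -1) (skewM n) := by
    ext i j
    rcases i with i | i <;> rcases j with j | j
    · fin_cases i <;> fin_cases j <;> simp [skewM, Fin.lt_def]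
    · have := i.2
      have h1 : ¬ (2 + (j : ℕ) < i) := by omega
      have h2 : (i : ℕ) < 2 + j := by omega
      simp [skewM, Fin.lt_def, h1, h2]
    · have h1 : (j : ℕ) < 2 + i := by omega
      simp [skewM, Fin.lt_def, h1]
    · simp [skewM]
  have hA : (!![0, 1; -1, 0] : Matrix (Fin 2) (Fin 2) ℝ) * !![0, -1; 1, 0] = 1 := by
    ext i j
    fin_cases i <;> fin_cases j <;> simp [Matrix.mul_apply]
  have hA' : !![0, -1; 1, 0] * (!![0, 1; -1, 0] : Matrix (Fin 2) (Fin 2) ℝ) = 1 := by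
    ext i j
    fin_cases i <;> fin_cases j <;> simp [Matrix.mul_apply]
  let _ : Invertible (!![0, 1; -1, 0] : Matrix (Fin 2) (Fin 2) ℝ) :=
    ⟨!![0, -1; 1, 0], hA', hA⟩
  rw [h, Matrix.det_fromBlocks₁₁]
  have h0 : ((Matrix.of (fun _ _ => -1) : Matrix (Fin n) (Fin 2) ℝ)
      * ⅟(!![0, 1; -1, 0] : Matrix (Fin 2) (Fin 2) ℝ)
      * (Matrix.of (fun _ _ => 1) : Matrix (Fin 2) (Fin n) ℝ)) = 0 := by
    change ((Matrix.of (fun _ _ => -1) : Matrix (Fin n) (Fin 2) ℝ)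
      * (!![0, -1; 1, 0] : Matrix (Fin 2) (Fin 2) ℝ)
      * (Matrix.of (fun _ _ => 1) : Matrix (Fin 2) (Fin n) ℝ)) = 0
    ext i j
    simp [Matrix.mul_apply, Fin.sum_univ_two]
  rw [h0]
  simp [Matrix.det_fin_two]

theorem skewM_det : ∀ n : ℕ, (skewM n).det = (1 + (-1 : ℝ) ^ n) / 2
  | 0 => by simp
  | 1 => by simp [skewM]
  | n + 2 => by
    rw [add_comm n 2, skewM_rec, skewM_det n]
    simp [pow_add]

theorem card_min_eq {n : ℕ} (π : Equiv.Perm (Fin n)) (hd : ∀ j, π j ≠ j) :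
    (Finset.univ.filter fun c => π c < c ∧ ¬ ∃ j, π.SameCycle c j ∧ j < π c).card
      = π.cycleFactorsFinset.card := by
  apply Finset.card_bij (fun c _ => π.cycleOf c)
  · intro c _
    rw [Equiv.Perm.cycleOf_mem_cycleFactorsFinset_iff, Equiv.Perm.mem_support]
    exact hd c
  · intro a ha b hb hab
    simp only [Finset.mem_filter, Finset.mem_univ, true_and, not_exists, not_and, not_lt] at ha hb
    have hs : π.SameCycle a b :=
      (Equiv.Perm.sameCycle_iff_cycleOf_eq_of_mem_support
        (Equiv.Perm.mem_support.2 (hd a)) (Equiv.Perm.mem_support.2 (hd b))).2 hab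
    have h1 := ha.2 (π b) (Equiv.Perm.sameCycle_apply_right.2 hs)
    have h2 := hb.2 (π a) (Equiv.Perm.sameCycle_apply_right.2 hs.symm)
    exact π.injective (le_antisymm h1 h2)
  · intro f hf
    have hc := (Equiv.Perm.mem_cycleFactorsFinset_iff.1 hf).1
    have hne : f.support.Nonempty := by
      obtain ⟨x, hx, _⟩ := hc
      exact ⟨x, Equiv.Perm.mem_support.2 hx⟩
    let m := f.support.min' hne
    have hm : m ∈ f.support := f.support.min'_mem hne
    have hfm : f = π.cycleOf m := Equiv.Perm.cycle_is_cycleOf hm hf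
    have hmin : ∀ j, π.SameCycle m j → m ≤ j := by
      intro j hj
      apply Finset.min'_le
      rw [hfm, Equiv.Perm.mem_support_cycleOf_iff]
      exact ⟨hj, Equiv.Perm.mem_support.2 (hd m)⟩
    obtain ⟨c, hcm⟩ := π.surjective m
    have hs : π.SameCycle m c := by
      rw [← hcm]
      exact Equiv.Perm.sameCycle_apply_left.2 (Equiv.Perm.SameCycle.refl _ _)
    refine ⟨c, ?_, ?_⟩
    · simp only [Finset.mem_filter, Finset.mem_univ, true_and, not_exists, not_and, not_lt]
      rw [hcm]
      refine ⟨lt_of_le_of_ne (hmin _ hs) ?_, fun j hj => hmin j (hs.trans hj)⟩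
      intro h
      exact hd c (hcm.trans h)
    · rw [hfm]
      exact hs.symm.cycleOf_eq

theorem neg_one_pow_cdes_s8 {n : ℕ} (π : Equiv.Perm (Fin n)) (hd : ∀ j, π j ≠ j) :
    (-1 : ℝ) ^ cdes π = (-1) ^ n * (((Equiv.Perm.sign π : ℤˣ) : ℤ) : ℝ) *
      (-1) ^ (Finset.univ.filter fun c => π c < c).card := by
  have hsupp : π.support = Finset.univ := by
    ext x
    simp [hd x]
  have hsplit : (Finset.univ.filter fun c => π c < c).card
      = cdes π + π.cycleFactorsFinset.card := by
    rw [← card_min_eq π hd, cdes, cdesSet,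
      ← Finset.card_filter_add_card_filter_not (s := Finset.univ.filter fun c => π c < c)
        (fun c => ∃ j, π.SameCycle c j ∧ j < π c), Finset.filter_filter, Finset.filter_filter]
  have hcard : Multiset.card π.cycleType = π.cycleFactorsFinset.card := by
    simp [Equiv.Perm.cycleType_def]
  rw [hsplit, Equiv.Perm.sign_of_cycleType, Equiv.Perm.sum_cycleType, hsupp, hcard]
  simp only [Finset.card_univ, Fintype.card_fin]
  push_cast
  rw [pow_add, pow_add]
  have h1 : ((-1 : ℝ) ^ n) * (-1) ^ n = 1 := by rw [← mul_pow]; simp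
  have h2 : ((-1 : ℝ) ^ π.cycleFactorsFinset.card) * (-1) ^ π.cycleFactorsFinset.card = 1 := by
    rw [← mul_pow]; simp
  linear_combination (-(-1 : ℝ) ^ cdes π) * h1 * (((-1 : ℝ) ^ π.cycleFactorsFinset.card) * (-1) ^ π.cycleFactorsFinset.card) - (-1 : ℝ) ^ cdes π * h2

theorem skewM_prod {n : ℕ} (π : Equiv.Perm (Fin n)) (hd : ∀ j, π j ≠ j) :
    ∏ i, (skewM n) i (π i) = (-1) ^ (Finset.univ.filter fun c => π c < c).card := by
  rw [← Finset.prod_const, Finset.prod_filter]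
  apply Finset.prod_congr rfl
  intro i _
  rcases lt_trichotomy (π i) i with h | h | h
  · simp [skewM, h]
  · exact absurd h (hd i)
  · simp [skewM, h, h.not_gt]

/-- Σ_{π ∈ D_n} (−1)^{cdes(π)} = (1 − (−1)^{n−1})/2 for n ≥ 1. -/
theorem signed_cdes_sum_derangements (n : ℕ) (hn : 1 ≤ n) :
    (∑ π ∈ Finset.univ.filter (fun π : Equiv.Perm (Fin n) => ∀ j, π j ≠ j),
        (-1 : ℝ) ^ cdes π) = (1 - (-1 : ℝ) ^ (n - 1)) / 2 := by
  have key : (∑ π ∈ Finset.univ.filter (fun π : Equiv.Perm (Fin n) => ∀ j, π j ≠ j),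
        (-1 : ℝ) ^ cdes π) = (-1) ^ n * (skewM n).det := by
    rw [← Matrix.det_transpose, Matrix.det_apply', Finset.mul_sum, Finset.sum_filter]
    apply Finset.sum_congr rfl
    intro π _
    simp only [Matrix.transpose_apply]
    split_ifs with hd
    · rw [neg_one_pow_cdes_s8 π hd, skewM_prod π hd, mul_assoc]
    · push Not at hd
      obtain ⟨j, hj⟩ := hd
      rw [Finset.prod_eq_zero (Finset.mem_univ j)]
      · simp
      · simp [skewM, hj]
  rw [key, skewM_det]
  obtain ⟨m, rfl⟩ : ∃ m, n = m + 1 := ⟨n - 1, by omega⟩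
  rw [Nat.add_sub_cancel]
  rcases neg_one_pow_eq_or ℝ m with h | h <;> rw [pow_succ, h] <;> norm_num
end

section
/- For x, y in a commutative ring (e.g. x, y ∈ ℝ) define P_{n,i}(x,y) = Σ_{π ∈ S_{n,i}} x^{exc(π)} y^{cdes(π)} and P_n(x,y) = Σ_{i=1}^{n} P_{n,i}(x,y). Then for every n ≥ 2: (i) P_{n+1,1}(x,y) = P_n(x,y); (ii) for every i with 2 ≤ i ≤ n+1, P_{n+1,i}(x,y) = x·P_{n−1}(x,y) + x·Σ_{j=2}^{i−1} P_{n,j}(x,y) + y·Σ_{j=i}^{n} P_{n,j}(x,y). The initial values are P_{1,1}(x,y) = 1, P_{2,1}(x,y) = 1, P_{2,2}(x,y) = x. -/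
open Equiv Finset

/-- S_{n,i}: permutations π of [n] with π(i) = 1, encoded on Fin n
(position i of [n] is the j : Fin n with j.val + 1 = i; element 1 is 0 : Fin n). -/
def Sni (n i : ℕ) : Finset (Equiv.Perm (Fin n)) :=
  Finset.univ.filter fun π => ∃ j : Fin n, (j : ℕ) + 1 = i ∧ ((π j : Fin n) : ℕ) = 0

/-- P_{n,i}(x,y) = Σ_{π ∈ S_{n,i}} x^{exc(π)} y^{cdes(π)}. -/
noncomputable def Pni (n i : ℕ) (x y : ℝ) : ℝ :=
  ∑ π ∈ Sni n i, x ^ exc π * y ^ cdes π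

/-- P_n(x,y) = Σ_{i=1}^n P_{n,i}(x,y). -/
noncomputable def Pn (n : ℕ) (x y : ℝ) : ℝ :=
  ∑ i ∈ Finset.Icc 1 n, Pni n i x y

/-- Weight of a permutation. -/
noncomputable def wt {n : ℕ} (x y : ℝ) (π : Equiv.Perm (Fin n)) : ℝ := x ^ exc π * y ^ cdes π

/-- Extend `τ` to fix `k`. -/
def liftP {n : ℕ} (k : Fin (n + 1)) (τ : Equiv.Perm (Fin n)) : Equiv.Perm (Fin (n + 1)) :=
  (finSuccEquiv' k).symm.permCongr (Equiv.optionCongr τ)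

theorem liftP_self {n : ℕ} (k : Fin (n + 1)) (τ : Equiv.Perm (Fin n)) : liftP k τ k = k := by
  simp [liftP, Equiv.permCongr_apply]

theorem liftP_succAbove {n : ℕ} (k : Fin (n + 1)) (τ : Equiv.Perm (Fin n)) (a : Fin n) :
    liftP k τ (k.succAbove a) = k.succAbove (τ a) := by
  simp [liftP, Equiv.permCongr_apply]

theorem liftP_inj {n : ℕ} (k : Fin (n + 1)) : Function.Injective (liftP k) := by
  intro τ σ h
  ext1 a
  have := congrArg (fun p : Equiv.Perm (Fin (n+1)) => p (k.succAbove a)) h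
  simpa [liftP_succAbove] using this

theorem liftP_surj {n : ℕ} (k : Fin (n + 1)) (π : Equiv.Perm (Fin (n + 1))) (h : π k = k) :
    ∃ τ, liftP k τ = π := by
  refine ⟨Equiv.removeNone ((finSuccEquiv' k).permCongr π), ?_⟩
  unfold liftP
  have h1 : ((finSuccEquiv' k).permCongr π) none = none := by
    simp [Equiv.permCongr_apply, h]
  rw [map_equiv_removeNone, h1]
  ext a
  simp [Equiv.permCongr_apply]

/-- Insert `k` just before `0`. -/
def extP {n : ℕ} (k : Fin (n + 1)) (τ : Equiv.Perm (Fin n)) : Equiv.Perm (Fin (n + 1)) :=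
  Equiv.swap k 0 * liftP k τ

theorem sum_ext {n : ℕ} (k : Fin (n + 1)) (f : Equiv.Perm (Fin (n + 1)) → ℝ) :
    ∑ π ∈ Finset.univ.filter (fun π : Equiv.Perm (Fin (n + 1)) => π k = 0), f π
      = ∑ τ : Equiv.Perm (Fin n), f (extP k τ) := by
  symm
  refine Finset.sum_bij (fun τ _ => extP k τ) ?_ ?_ ?_ ?_
  · intro τ _
    simp [extP, liftP_self]
  · intro a _ b _ h
    exact liftP_inj k (mul_left_cancel h)
  · intro π hπ
    simp only [Finset.mem_filter, Finset.mem_univ, true_and] at hπ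
    obtain ⟨τ, hτ⟩ := liftP_surj k (Equiv.swap k 0 * π) (by simp [hπ])
    refine ⟨τ, Finset.mem_univ _, ?_⟩
    simp [extP, hτ, ← mul_assoc]
  · intros; rfl

theorem sameCycle_map {α β : Type*} (π : Equiv.Perm α) (τ : Equiv.Perm β) (f : α → β)
    (h : ∀ c, τ.SameCycle (f c) (f (π c))) {a b : α} (hab : π.SameCycle a b) :
    τ.SameCycle (f a) (f b) := by
  obtain ⟨z, rfl⟩ := hab
  induction z using Int.induction_on with
  | zero => exact Equiv.Perm.SameCycle.refl _ _
  | succ i ih =>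
    have := h ((π ^ (i : ℤ)) a)
    rw [add_comm, zpow_add, zpow_one, Equiv.Perm.mul_apply]
    exact ih.trans this
  | pred i ih =>
    have := h ((π ^ (-(i : ℤ) - 1)) a)
    rw [← Equiv.Perm.mul_apply, ← zpow_one_add] at this
    rw [show (1 : ℤ) + (-(i : ℤ) - 1) = -i by ring] at this
    exact ih.trans this.symm

theorem extP_self {n : ℕ} (k : Fin (n + 1)) (τ : Equiv.Perm (Fin n)) : extP k τ k = 0 := by
  simp [extP, liftP_self]

theorem extP_of_ne {n : ℕ} (k : Fin (n + 2)) (hk : k ≠ 0) (τ : Equiv.Perm (Fin (n + 1)))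
    (a : Fin (n + 1)) (ha : τ a ≠ 0) : extP k τ (k.succAbove a) = k.succAbove (τ a) := by
  simp only [extP, Equiv.Perm.mul_apply, liftP_succAbove]
  apply Equiv.swap_apply_of_ne_of_ne
  · exact Fin.succAbove_ne _ _
  · rwa [Ne, Fin.succAbove_eq_zero_iff hk]

theorem extP_of_eq {n : ℕ} (k : Fin (n + 2)) (hk : k ≠ 0) (τ : Equiv.Perm (Fin (n + 1)))
    (a : Fin (n + 1)) (ha : τ a = 0) : extP k τ (k.succAbove a) = k := by
  simp only [extP, Equiv.Perm.mul_apply, liftP_succAbove]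
  rw [ha, Fin.succAbove_ne_zero_zero hk, Equiv.swap_apply_right]

theorem sameCycle_ext {n : ℕ} (k : Fin (n + 2)) (hk : k ≠ 0) (τ : Equiv.Perm (Fin (n + 1)))
    (a b : Fin (n + 1)) :
    (extP k τ).SameCycle (k.succAbove a) (k.succAbove b) ↔ τ.SameCycle a b := by
  constructor
  · intro h
    have := sameCycle_map (extP k τ) τ (fun c => ((finSuccEquiv' k) c).getD 0) ?_ h
    · simpa using this
    · intro c
      rcases Fin.eq_self_or_eq_succAbove k c with rfl | ⟨a, rfl⟩
      · rw [extP_self]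
        have h0 : (0 : Fin (n + 2)) = c.succAbove 0 := (Fin.succAbove_ne_zero_zero hk).symm
        rw [h0]
        simp only [finSuccEquiv'_succAbove, finSuccEquiv'_at, Option.getD_some, Option.getD_none]
        exact Equiv.Perm.SameCycle.refl _ _
      · by_cases ha : τ a = 0
        · rw [extP_of_eq k hk τ a ha]
          simp only [finSuccEquiv'_succAbove, finSuccEquiv'_at, Option.getD_some, Option.getD_none]
          exact ⟨1, by simpa using ha⟩
        · rw [extP_of_ne k hk τ a ha]
          simp only [finSuccEquiv'_succAbove, Option.getD_some]
          exact ⟨1, by simp⟩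
  · intro h
    refine sameCycle_map τ (extP k τ) k.succAbove ?_ h
    intro c
    by_cases hc : τ c = 0
    · refine ⟨2, ?_⟩
      rw [show (2 : ℤ) = 1 + 1 from rfl, zpow_add, zpow_one, Equiv.Perm.mul_apply,
        extP_of_eq k hk τ c hc, extP_self, hc, Fin.succAbove_ne_zero_zero hk]
    · exact ⟨1, by rw [zpow_one, extP_of_ne k hk τ c hc]⟩

theorem sameCycle_ext_self {n : ℕ} (k : Fin (n + 2)) (τ : Equiv.Perm (Fin (n + 1))) :
    (extP k τ).SameCycle k 0 := ⟨1, by simp [extP_self]⟩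

theorem exc_ext {n : ℕ} (k : Fin (n + 2)) (hk : k ≠ 0) (τ : Equiv.Perm (Fin (n + 1)))
    (j : Fin (n + 1)) (hj : τ j = 0) :
    exc (extP k τ) = exc τ + if k.succAbove j < k then 1 else 0 := by
  unfold exc
  rw [Finset.card_filter, Finset.card_filter, Fin.sum_univ_succAbove _ k, extP_self,
    ← Finset.add_sum_erase _ _ (Finset.mem_univ j), ← Finset.add_sum_erase _ _ (Finset.mem_univ j),
    extP_of_eq k hk τ j hj, hj]
  have : ∑ a ∈ Finset.univ.erase j,
        (if k.succAbove a < extP k τ (k.succAbove a) then 1 else 0)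
      = ∑ a ∈ Finset.univ.erase j, if a < τ a then 1 else 0 := by
    refine Finset.sum_congr rfl fun a ha => ?_
    have ha' : τ a ≠ 0 := fun h => Finset.ne_of_mem_erase ha (τ.injective (h.trans hj.symm))
    rw [extP_of_ne k hk τ a ha']
    exact if_congr Fin.succAbove_lt_succAbove_iff rfl rfl
  rw [this]
  simp [add_comm]

theorem cdes_ext {n : ℕ} (k : Fin (n + 2)) (hk : k ≠ 0) (τ : Equiv.Perm (Fin (n + 1)))
    (j : Fin (n + 1)) (hj : τ j = 0) :
    cdes (extP k τ) = cdes τ + if k.succAbove j < k then 0 else 1 := by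
  classical
  have h0 : k.succAbove 0 = 0 := Fin.succAbove_ne_zero_zero hk
  unfold cdes cdesSet
  rw [Finset.card_filter, Finset.card_filter, Fin.sum_univ_succAbove _ k, extP_self,
    ← Finset.add_sum_erase _ _ (Finset.mem_univ j), ← Finset.add_sum_erase _ _ (Finset.mem_univ j),
    extP_of_eq k hk τ j hj, hj]
  have : ∑ a ∈ Finset.univ.erase j,
        (if extP k τ (k.succAbove a) < k.succAbove a ∧ ∃ b, (extP k τ).SameCycle (k.succAbove a) b ∧
          b < extP k τ (k.succAbove a) then 1 else 0)
      = ∑ a ∈ Finset.univ.erase j, if τ a < a ∧ ∃ b, τ.SameCycle a b ∧ b < τ a then 1 else 0 := by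
    refine Finset.sum_congr rfl fun a ha => ?_
    have ha' : τ a ≠ 0 := fun h => Finset.ne_of_mem_erase ha (τ.injective (h.trans hj.symm))
    rw [extP_of_ne k hk τ a ha']
    refine if_congr (and_congr Fin.succAbove_lt_succAbove_iff ?_) rfl rfl
    constructor
    · rintro ⟨b, hb, hlt⟩
      rcases Fin.eq_self_or_eq_succAbove k b with rfl | ⟨b, rfl⟩
      · refine ⟨0, ?_, Fin.pos_of_ne_zero ha'⟩
        rw [← sameCycle_ext b hk, h0]
        exact hb.trans (sameCycle_ext_self b τ)
      · exact ⟨b, (sameCycle_ext k hk τ a b).1 hb, Fin.succAbove_lt_succAbove_iff.1 hlt⟩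
    · rintro ⟨b, hb, hlt⟩
      exact ⟨_, (sameCycle_ext k hk τ a b).2 hb, Fin.succAbove_lt_succAbove_iff.2 hlt⟩
  rw [this]
  have h2 : (k < k.succAbove j ∧ ∃ b, (extP k τ).SameCycle (k.succAbove j) b ∧ b < k) ↔
      ¬ k.succAbove j < k := by
    constructor
    · rintro ⟨h, _⟩
      exact h.asymm
    · intro h
      refine ⟨lt_of_le_of_ne (not_lt.1 h) (Fin.succAbove_ne _ _).symm, 0, ?_, Fin.pos_of_ne_zero hk⟩
      rw [← h0, sameCycle_ext k hk]
      exact ⟨1, by simpa using hj⟩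
  simp only [h2]
  by_cases hh : k.succAbove j < k <;> simp [hh, add_comm]

theorem extP_zero {n : ℕ} (τ : Equiv.Perm (Fin n)) (a : Fin n) :
    extP 0 τ a.succ = (τ a).succ := by
  have := liftP_succAbove 0 τ a
  simpa [extP] using this

theorem exc_ext_zero {n : ℕ} (τ : Equiv.Perm (Fin n)) : exc (extP 0 τ) = exc τ := by
  unfold exc
  rw [Finset.card_filter, Finset.card_filter, Fin.sum_univ_succ, extP_self]
  simp [extP_zero]

theorem cdes_ext_zero {n : ℕ} (τ : Equiv.Perm (Fin (n + 1))) : cdes (extP 0 τ) = cdes τ := by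
  classical
  unfold cdes cdesSet
  rw [Finset.card_filter, Finset.card_filter, Fin.sum_univ_succ, extP_self]
  simp only [extP_zero, lt_irrefl, false_and, if_false, zero_add, Fin.succ_lt_succ_iff]
  refine Finset.sum_congr rfl fun a _ => ?_
  congr 1
  refine propext (and_congr_right fun _ => ?_)
  constructor
  · rintro ⟨b, hb, hlt⟩
    cases b using Fin.cases with
    | zero =>
      have := hb.symm.eq_of_left (show Function.IsFixedPt _ _ from extP_self 0 τ)
      exact absurd this.symm (Fin.succ_ne_zero a)
    | succ b =>
      refine ⟨b, ?_, Fin.succ_lt_succ_iff.1 hlt⟩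
      have := sameCycle_map (extP 0 τ) τ (fun c => Fin.cases 0 id c) ?_ hb
      · simpa using this
      · intro c
        cases c using Fin.cases with
        | zero => rw [extP_self]
        | succ c => rw [extP_zero]; exact ⟨1, by simp⟩
  · rintro ⟨b, hb, hlt⟩
    refine ⟨b.succ, sameCycle_map τ (extP 0 τ) Fin.succ ?_ hb, Fin.succ_lt_succ_iff.2 hlt⟩
    intro c
    exact ⟨1, by simp [extP_zero]⟩

theorem Pni_fin {n : ℕ} (x y : ℝ) (k : Fin (n + 1)) :
    Pni (n + 1) (k + 1) x y =
      ∑ π ∈ Finset.univ.filter (fun π : Equiv.Perm (Fin (n + 1)) => π k = 0), wt x y π := by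
  unfold Pni wt
  refine Finset.sum_congr ?_ fun _ _ => rfl
  ext π
  simp only [Sni, Finset.mem_filter, Finset.mem_univ, true_and]
  constructor
  · rintro ⟨j, hj, h⟩
    obtain rfl : j = k := Fin.ext (by omega)
    exact Fin.ext h
  · intro h
    exact ⟨k, rfl, by rw [h]; rfl⟩

theorem sum_fiber {n : ℕ} (x y : ℝ) (g : Fin (n + 1) → ℝ) :
    ∑ τ : Equiv.Perm (Fin (n + 1)), wt x y τ * g (τ⁻¹ 0)
      = ∑ j : Fin (n + 1), Pni (n + 1) (j + 1) x y * g j := by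
  rw [← Finset.sum_fiberwise _ (fun τ : Equiv.Perm (Fin (n + 1)) => τ⁻¹ 0)]
  refine Finset.sum_congr rfl fun j _ => ?_
  rw [Pni_fin, Finset.sum_mul]
  refine Finset.sum_congr ?_ ?_
  · ext τ
    simp only [Finset.mem_filter, Finset.mem_univ, true_and]
    rw [Equiv.Perm.inv_eq_iff_eq, eq_comm]
  · intro τ hτ
    simp only [Finset.mem_filter, Finset.mem_univ, true_and] at hτ
    rw [← hτ]
    simp

theorem Pn_eq {n : ℕ} (x y : ℝ) :
    Pn (n + 1) x y = ∑ τ : Equiv.Perm (Fin (n + 1)), wt x y τ := by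
  have := sum_fiber (n := n) x y (fun _ => 1)
  simp only [mul_one] at this
  rw [this, Fin.sum_univ_eq_sum_range (fun j => Pni (n + 1) (j + 1) x y), Pn,
    Finset.range_eq_Ico, Finset.sum_Ico_add' (fun j => Pni (n + 1) j x y)]
  rfl

theorem Pni_one_eq {n : ℕ} (x y : ℝ) : Pni (n + 2) 1 x y = Pn (n + 1) x y := by
  have := Pni_fin (n := n + 1) x y 0
  simp only [Fin.val_zero, zero_add] at this
  rw [this, Pn_eq, sum_ext]
  refine Finset.sum_congr rfl fun τ _ => ?_
  rw [wt, wt, exc_ext_zero, cdes_ext_zero]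

theorem Pni_succ_eq {n : ℕ} (x y : ℝ) (k : ℕ) (hk : k < n + 1) :
    Pni (n + 2) (k + 2) x y =
      ∑ j ∈ Finset.range (n + 1), Pni (n + 1) (j + 1) x y * (if j < k + 1 then x else y) := by
  have := Pni_fin (n := n + 1) x y ⟨k + 1, by omega⟩
  rw [show k + 2 = k + 1 + 1 from rfl, this, sum_ext,
    ← Fin.sum_univ_eq_sum_range
      (fun j => Pni (n + 1) (j + 1) x y * (if j < k + 1 then x else y)),
    ← sum_fiber x y (fun j : Fin (n + 1) => if (j : ℕ) < k + 1 then x else y)]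
  refine Finset.sum_congr rfl fun τ _ => ?_
  set K : Fin (n + 2) := ⟨k + 1, by omega⟩ with hK
  have hK0 : K ≠ 0 := by simp [hK, Fin.ext_iff]
  have hj : τ (τ⁻¹ 0) = 0 := by simp
  rw [wt, wt, exc_ext K hK0 τ _ hj, cdes_ext K hK0 τ _ hj]
  have : K.succAbove (τ⁻¹ 0) < K ↔ ((τ⁻¹ 0 : Fin (n + 1)) : ℕ) < k + 1 := by
    rw [Fin.succAbove_lt_iff_castSucc_lt, Fin.lt_def]
    simp [hK]
  simp only [this]
  split_ifs <;> ring

theorem Pni_one_one (x y : ℝ) : Pni 1 1 x y = 1 := by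
  have h := Pni_fin (n := 0) x y 0
  simp only [Fin.val_zero, zero_add] at h
  have hs : ∀ a b : Fin (0 + 1), ¬ a < b := by
    intro a b hab
    have := a.isLt
    have := b.isLt
    have := Fin.lt_def.1 hab
    omega
  rw [h, sum_ext, Fintype.sum_subsingleton _ 1]
  simp only [wt, exc, cdes, cdesSet, hs, false_and, Finset.filter_false, Finset.card_empty,
    pow_zero, mul_one]

theorem Pni_recurrence (x y : ℝ) :
    Pni 1 1 x y = 1 ∧ Pni 2 1 x y = 1 ∧ Pni 2 2 x y = x ∧
    ∀ n : ℕ, 2 ≤ n →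
      Pni (n + 1) 1 x y = Pn n x y ∧
      ∀ i : ℕ, 2 ≤ i → i ≤ n + 1 →
        Pni (n + 1) i x y =
          x * Pn (n - 1) x y + x * ∑ j ∈ Finset.Icc 2 (i - 1), Pni n j x y +
            y * ∑ j ∈ Finset.Icc i n, Pni n j x y := by
  refine ⟨Pni_one_one x y, ?_, ?_, ?_⟩
  · rw [Pni_one_eq (n := 0)]
    simp [Pn, Pni_one_one]
  · rw [Pni_succ_eq (n := 0) x y 0 (by omega)]
    simp [Pni_one_one]
  · intro n hn
    obtain ⟨m, rfl⟩ : ∃ m, n = m + 2 := ⟨n - 2, by omega⟩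
    refine ⟨Pni_one_eq x y, ?_⟩
    intro i hi hin
    obtain ⟨k, rfl⟩ : ∃ k, i = k + 2 := ⟨i - 2, by omega⟩
    rw [Pni_succ_eq (n := m + 1) x y k (by omega), Finset.sum_range_succ']
    simp only [Nat.succ_lt_succ_iff, zero_add, Nat.zero_lt_succ, if_true]
    rw [Pni_one_eq, show m + 2 - 1 = m + 1 from rfl, show k + 2 - 1 = k + 1 from rfl,
      ← Finset.sum_range_add_sum_Ico _ (show k ≤ m + 1 by omega)]
    have h1 : ∑ j ∈ Finset.range k, Pni (m + 2) (j + 1 + 1) x y * (if j < k then x else y)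
        = x * ∑ j ∈ Finset.Icc 2 (k + 1), Pni (m + 2) j x y := by
      rw [show Finset.Icc 2 (k + 1) = Finset.Ico (0 + 2) (k + 2) from rfl,
        ← Finset.sum_Ico_add' (fun j => Pni (m + 2) j x y), ← Finset.range_eq_Ico, Finset.mul_sum]
      refine Finset.sum_congr rfl fun j hj => ?_
      rw [if_pos (Finset.mem_range.1 hj), mul_comm]
    have h2 : ∑ j ∈ Finset.Ico k (m + 1), Pni (m + 2) (j + 1 + 1) x y * (if j < k then x else y)
        = y * ∑ j ∈ Finset.Icc (k + 2) (m + 2), Pni (m + 2) j x y := by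
      rw [show Finset.Icc (k + 2) (m + 2) = Finset.Ico (k + 2) (m + 1 + 2) from rfl,
        ← Finset.sum_Ico_add' (fun j => Pni (m + 2) j x y), Finset.mul_sum]
      refine Finset.sum_congr rfl fun j hj => ?_
      rw [if_neg (not_lt.2 (Finset.mem_Ico.1 hj).1), mul_comm]
    rw [h1, h2]
    ring
end
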